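/- The metric space (M^p, OT_p) is a complete separable (Polish) metric space, for any p ∈ [1,∞). -/

import Mathlib

noncomputable section

open MeasureTheory Metric Set Filter Topology ENNReal
open scoped Classical

/-- The plane with the Euclidean distance. -/
abbrev Pt : Type := EuclideanSpace ℝ (Fin 2)

/-- Build a point of the plane from coordinates. -/
def mk2 (a b : ℝ) : Pt := (WithLp.equiv 2 (Fin 2 → ℝ)).symm ![a, b]

/-- The open upper half-plane Ω = {(t₁,t₂) : t₂ > t₁}. -/
def UHP : Set Pt := {x | x 0 < x 1}

/-- The diagonal ∂Ω = {(t,t)}. -/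
def Diag : Set Pt := {x | x 0 = x 1}

/-- Ω̄ = Ω ∪ ∂Ω. -/
def UHPbar : Set Pt := UHP ∪ Diag

/-- Distance from a point to the diagonal. -/
def persDist (x : Pt) : ℝ := infDist x Diag

/-- p-th total persistence Pers_p(μ) = ∫_Ω d(x,∂Ω)^p dμ(x). -/
def Pers (p : ℝ) (μ : Measure Pt) : ℝ≥0∞ :=
  ∫⁻ x in UHP, ENNReal.ofReal (persDist x ^ p) ∂μ

/-- μ ∈ M^p : a measure supported on Ω with finite p-th persistence. -/
def MemMp (p : ℝ) (μ : Measure Pt) : Prop := μ UHPᶜ = 0 ∧ Pers p μ < ⊤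

/-- Admissible partial transport plans between μ and ν: measures on Ω̄ × Ω̄ whose
marginals restricted to Ω are μ and ν. -/
def Adm (μ ν : Measure Pt) : Set (Measure (Pt × Pt)) :=
  {π | π ((UHPbar ×ˢ UHPbar)ᶜ) = 0 ∧
    (∀ A : Set Pt, MeasurableSet A → A ⊆ UHP → π (A ×ˢ univ) = μ A) ∧
    (∀ B : Set Pt, MeasurableSet B → B ⊆ UHP → π (univ ×ˢ B) = ν B)}

/-- Cost C_p(π) = ∬ d(x,y)^p dπ(x,y). -/
def Cost (p : ℝ) (π : Measure (Pt × Pt)) : ℝ≥0∞ :=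
  ∫⁻ z, ENNReal.ofReal (dist z.1 z.2 ^ p) ∂π

/-- OT_p(μ,ν)^p, as an extended real. -/
def OTe (p : ℝ) (μ ν : Measure Pt) : ℝ≥0∞ := ⨅ π ∈ Adm μ ν, Cost p π

/-- The optimal partial transport distance OT_p(μ,ν). -/
def OT (p : ℝ) (μ ν : Measure Pt) : ℝ := (OTe p μ ν ^ (1 / p)).toReal

/-- Optimal plans. -/
def OptSet (p : ℝ) (μ ν : Measure Pt) : Set (Measure (Pt × Pt)) :=
  {π | π ∈ Adm μ ν ∧ Cost p π = OTe p μ ν}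

/-- Vague convergence of measures on Ω: convergence of integrals of continuous
functions compactly supported in Ω. -/
def VagueTendsto (μs : ℕ → Measure Pt) (μ : Measure Pt) : Prop :=
  ∀ f : Pt → ℝ, Continuous f → HasCompactSupport f → tsupport f ⊆ UHP →
    Tendsto (fun n => ∫ x, f x ∂(μs n)) atTop (𝓝 (∫ x, f x ∂μ))

/-- E_Ω = (Ω̄ × Ω̄) \ (∂Ω × ∂Ω). -/
def EOm : Set (Pt × Pt) := (UHPbar ×ˢ UHPbar) \ (Diag ×ˢ Diag)

/-- Vague convergence of plans on E_Ω. -/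
def VaguePlanTendsto (πs : ℕ → Measure (Pt × Pt)) (π : Measure (Pt × Pt)) : Prop :=
  ∀ f : Pt × Pt → ℝ, Continuous f → HasCompactSupport f → tsupport f ⊆ EOm →
    Tendsto (fun n => ∫ z, f z ∂(πs n)) atTop (𝓝 (∫ z, f z ∂π))

/-- A persistence diagram: an ℕ-valued point measure Σ_{x ∈ X} n_x δ_x with
X ⊆ Ω locally finite in Ω. -/
def IsDiagram (μ : Measure Pt) : Prop :=
  ∃ (X : Set Pt) (n : Pt → ℕ), X ⊆ UHP ∧
    (∀ x ∈ UHP, ∃ U ∈ 𝓝 x, (X ∩ U).Finite) ∧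
    μ = Measure.sum (fun x : X => (n x.1 : ℝ≥0∞) • Measure.dirac (x.1 : Pt))

/-- Support of a measure on Pt × Pt. -/
def msupp (π : Measure (Pt × Pt)) : Set (Pt × Pt) := {z | ∀ U ∈ 𝓝 z, π U ≠ 0}

/-- Support of a measure on Pt. -/
def suppM (μ : Measure Pt) : Set Pt := {x | ∀ U ∈ 𝓝 x, μ U ≠ 0}

/-- Bottleneck cost of a plan: sup of d(x,y) over the support. -/
def CostInf (π : Measure (Pt × Pt)) : ℝ≥0∞ :=
  ⨆ z ∈ msupp π, ENNReal.ofReal (dist z.1 z.2)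

/-- The bottleneck (∞) optimal partial transport distance, as extended real. -/
def OTinfE (μ ν : Measure Pt) : ℝ≥0∞ := ⨅ π ∈ Adm μ ν, CostInf π

/-- μ ∈ M^∞ : support at bounded distance from the diagonal. -/
def MemMinf (μ : Measure Pt) : Prop :=
  μ UHPᶜ = 0 ∧ ∃ C : ℝ, ∀ x ∈ suppM μ, persDist x ≤ C

/-- A partial matching between two indexed families: a bijection between
subsets of the index sets; unmatched points are sent to the diagonal. -/
structure Matching (ι κ : Type*) where
  I : Set ι
  J : Set κ
  e : I ≃ J

/-- Cost of a partial matching for d_p (as the p-th power, extended real). -/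
def mCost (p : ℝ) {ι κ : Type*} (x : ι → Pt) (y : κ → Pt) (m : Matching ι κ) : ℝ≥0∞ :=
  (∑' i : m.I, ENNReal.ofReal (dist (x i.1) (y (m.e i).1) ^ p))
  + (∑' i : ↥(m.Iᶜ), ENNReal.ofReal (persDist (x i.1) ^ p))
  + (∑' j : ↥(m.Jᶜ), ENNReal.ofReal (persDist (y j.1) ^ p))

/-- Bottleneck cost of a partial matching. -/
def mCostInf {ι κ : Type*} (x : ι → Pt) (y : κ → Pt) (m : Matching ι κ) : ℝ≥0∞ :=
  (⨆ i : m.I, ENNReal.ofReal (dist (x i.1) (y (m.e i).1)))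
  ⊔ (⨆ i : ↥(m.Iᶜ), ENNReal.ofReal (persDist (x i.1)))
  ⊔ (⨆ j : ↥(m.Jᶜ), ENNReal.ofReal (persDist (y j.1)))

/-- The point measure associated to an indexed family of points. -/
def famMeasure {ι : Type*} (x : ι → Pt) : Measure Pt :=
  Measure.sum (fun i => Measure.dirac (x i))

/-- The weighted measure μ^p, with density d(x,∂Ω)^p with respect to μ. -/
def wgt (p : ℝ) (μ : Measure Pt) : Measure Pt :=
  μ.withDensity (fun x => ENNReal.ofReal (persDist x ^ p))

/-- The quotient space Ω̃ = Ω ⊔ {∂Ω}. -/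
def Qt : Type := Option ↥UHP

/-- The quotient metric ρ on Ω̃. -/
def ρQ : Qt → Qt → ℝ
  | some x, some y => min (dist (x : Pt) (y : Pt)) (persDist x + persDist y)
  | some x, none => persDist x
  | none, some y => persDist y
  | none, none => 0

/-- The quotient metric ρ viewed on the plane, all diagonal points being
identified. -/
def ρP (x y : Pt) : ℝ :=
  if x ∈ Diag then (if y ∈ Diag then 0 else persDist y)
  else if y ∈ Diag then persDist x
  else min (dist x y) (persDist x + persDist y)

/-- Couplings with full (equal-mass) marginals. -/
def Coup (μ ν : Measure Pt) : Set (Measure (Pt × Pt)) :=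
  {π | π.map Prod.fst = μ ∧ π.map Prod.snd = ν}

/-- The p-Wasserstein distance (to the p) for the quotient metric ρ. -/
def WpE (p : ℝ) (μ ν : Measure Pt) : ℝ≥0∞ :=
  ⨅ π ∈ Coup μ ν, ∫⁻ z, ENNReal.ofReal (ρP z.1 z.2 ^ p) ∂π


/-- The space M^p as a subtype. -/
def MpT (p : ℝ) : Type := {μ : Measure Pt // MemMp p μ}


lemma meas_coord (i : Fin 2) : Measurable (fun x : Pt => x i) := by fun_prop
lemma cont_coord (i : Fin 2) : Continuous (fun x : Pt => x i) := by fun_prop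

lemma isOpen_UHP : IsOpen UHP := isOpen_lt (cont_coord 0) (cont_coord 1)
lemma isClosed_Diag : IsClosed Diag := isClosed_eq (cont_coord 0) (cont_coord 1)
lemma UHPbar_eq : UHPbar = {x : Pt | x 0 ≤ x 1} := by
  ext x; simp only [UHPbar, UHP, Diag, mem_union, mem_ofPred_eq]; exact le_iff_lt_or_eq.symm
lemma isClosed_UHPbar : IsClosed UHPbar := by
  rw [UHPbar_eq]; exact isClosed_le (cont_coord 0) (cont_coord 1)
lemma meas_UHP : MeasurableSet UHP := isOpen_UHP.measurableSet
lemma meas_UHPbar : MeasurableSet UHPbar := isClosed_UHPbar.measurableSet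
lemma Diag_nonempty : Diag.Nonempty := ⟨0, by simp [Diag]⟩
lemma UHP_sub : UHP ⊆ UHPbar := subset_union_left
lemma Diag_sub : Diag ⊆ UHPbar := subset_union_right
lemma Diag_not {x : Pt} (h : x ∈ Diag) : x ∉ UHP := by
  simp only [Diag, UHP, mem_ofPred_eq] at *; linarith
lemma bar_not {x : Pt} (h : x ∈ UHPbar) (h' : x ∉ UHP) : x ∈ Diag := h.resolve_left h'

lemma cont_persDist : Continuous persDist := continuous_infDist_pt _
lemma persDist_nonneg (x : Pt) : 0 ≤ persDist x := infDist_nonneg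
lemma persDist_pos {x : Pt} (h : x ∈ UHP) : 0 < persDist x :=
  (isClosed_Diag.notMem_iff_infDist_pos Diag_nonempty).1 (fun h' => Diag_not h' h)
lemma persDist_diag {x : Pt} (h : x ∈ Diag) : persDist x = 0 := infDist_zero_of_mem h

/-- projection to the diagonal -/
def prj (x : Pt) : Pt := mk2 ((x 0 + x 1) / 2) ((x 0 + x 1) / 2)

lemma prj_mem (x : Pt) : prj x ∈ Diag := by simp [prj, mk2, Diag]
lemma meas_prj : Measurable prj := by
  have : Continuous prj := by
    unfold prj mk2
    simp only [WithLp.equiv_symm_apply]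
    fun_prop
  exact this.measurable
lemma dist_prj (x : Pt) : dist x (prj x) = persDist x := by
  apply le_antisymm
  · refine (le_infDist Diag_nonempty).2 fun y hy => ?_
    rw [EuclideanSpace.dist_eq, EuclideanSpace.dist_eq]
    apply Real.sqrt_le_sqrt
    simp only [Fin.sum_univ_two, Real.dist_eq, sq_abs, prj, mk2, WithLp.equiv_symm_apply]
    simp only [Diag, mem_ofPred_eq] at hy
    simp
    rw [hy]
    nlinarith [sq_nonneg (x 0 + x 1 - 2 * y 1)]
  · exact infDist_le_dist_of_mem (prj_mem x)

/-- weight -/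
def wt (p : ℝ) (x : Pt) : ℝ≥0∞ := ENNReal.ofReal (persDist x ^ p)
lemma meas_wt (p : ℝ) : Measurable (wt p) := by
  unfold wt; have := cont_persDist.measurable; fun_prop
lemma wt_pos {p : ℝ} {x : Pt} (h : x ∈ UHP) : wt p x ≠ 0 := by
  have := Real.rpow_pos_of_pos (persDist_pos h) p
  simp [wt, this]
lemma wt_top {p : ℝ} {x : Pt} : wt p x ≠ ⊤ := by simp [wt]
lemma wt_eq {p : ℝ} (hp : 1 ≤ p) (x : Pt) : wt p x = edist x (prj x) ^ p := by
  rw [wt, ← dist_prj, edist_dist, ENNReal.ofReal_rpow_of_nonneg dist_nonneg (by linarith)]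
lemma Pers_eq (p : ℝ) (μ : Measure Pt) : Pers p μ = ∫⁻ x in UHP, wt p x ∂μ := rfl

lemma Cost_eq {p : ℝ} (hp : 1 ≤ p) (π : Measure (Pt × Pt)) :
    Cost p π = ∫⁻ z, edist z.1 z.2 ^ p ∂π := by
  unfold Cost
  congr 1; ext z
  rw [edist_dist, ENNReal.ofReal_rpow_of_nonneg dist_nonneg (by linarith)]

lemma meas_edistp (p : ℝ) : Measurable (fun z : Pt × Pt => edist z.1 z.2 ^ p) := by fun_prop

lemma restrict_UHP {μ : Measure Pt} (h : μ UHPᶜ = 0) : μ.restrict UHP = μ :=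
  Measure.restrict_eq_self_of_ae_mem (by rwa [ae_iff])

lemma mem_Adm_iff {μ ν : Measure Pt} {π : Measure (Pt × Pt)} : π ∈ Adm μ ν ↔
    (∀ᵐ z ∂π, z.1 ∈ UHPbar ∧ z.2 ∈ UHPbar) ∧ (π.map Prod.fst).restrict UHP = μ.restrict UHP ∧
      (π.map Prod.snd).restrict UHP = ν.restrict UHP := by
  have key : ∀ (f : Pt × Pt → Pt) (hf : Measurable f) (μ : Measure Pt),
      (∀ A : Set Pt, MeasurableSet A → A ⊆ UHP → π (f ⁻¹' A) = μ A) ↔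
      (π.map f).restrict UHP = μ.restrict UHP := by
    intro f hf μ
    constructor
    · intro h
      ext A hA
      rw [Measure.restrict_apply hA, Measure.restrict_apply hA,
        Measure.map_apply hf (hA.inter meas_UHP)]
      exact h _ (hA.inter meas_UHP) inter_subset_right
    · intro h A hA hAU
      have := congrArg (fun m => m A) h
      simp only [Measure.restrict_apply hA, inter_eq_left.2 hAU] at this
      rwa [Measure.map_apply hf hA] at this
  rw [← key _ measurable_fst, ← key _ measurable_snd]
  simp only [Adm, mem_ofPred_eq]
  refine and_congr Iff.rfl (and_congr ?_ ?_)
  · simp only [prod_univ]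
  · simp only [univ_prod]

lemma Adm_fst {μ ν : Measure Pt} {π : Measure (Pt × Pt)} (h : π ∈ Adm μ ν) {g : Pt → ℝ≥0∞}
    (hg : Measurable g) : ∫⁻ z in Prod.fst ⁻¹' UHP, g z.1 ∂π = ∫⁻ x in UHP, g x ∂μ := by
  rw [← (mem_Adm_iff.1 h).2.1, Measure.restrict_map measurable_fst meas_UHP,
    lintegral_map hg measurable_fst]
lemma Adm_snd {μ ν : Measure Pt} {π : Measure (Pt × Pt)} (h : π ∈ Adm μ ν) {g : Pt → ℝ≥0∞}
    (hg : Measurable g) : ∫⁻ z in Prod.snd ⁻¹' UHP, g z.2 ∂π = ∫⁻ x in UHP, g x ∂ν := by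
  rw [← (mem_Adm_iff.1 h).2.2, Measure.restrict_map measurable_snd meas_UHP,
    lintegral_map hg measurable_snd]

/-- Plans coming from random variables. -/
lemma Adm_map {α : Type*} [MeasurableSpace α] {P : Measure α} {X Y : α → Pt} (hX : Measurable X)
    (hY : Measurable Y) {μ ν : Measure Pt} (hXb : ∀ᵐ a ∂P, X a ∈ UHPbar)
    (hYb : ∀ᵐ a ∂P, Y a ∈ UHPbar)
    (h1 : (P.map X).restrict UHP = μ.restrict UHP) (h2 : (P.map Y).restrict UHP = ν.restrict UHP) :
    P.map (fun a => (X a, Y a)) ∈ Adm μ ν := by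
  have hm : Measurable fun a => (X a, Y a) := hX.prodMk hY
  rw [mem_Adm_iff, Measure.map_map measurable_fst hm, Measure.map_map measurable_snd hm]
  refine ⟨?_, h1, h2⟩
  refine (ae_map_iff (p := fun z : Pt × Pt => z.1 ∈ UHPbar ∧ z.2 ∈ UHPbar) hm.aemeasurable
    ((measurable_fst meas_UHPbar).inter (measurable_snd meas_UHPbar))).2 ?_
  filter_upwards [hXb, hYb] with a ha hb using ⟨ha, hb⟩

lemma OTe_le {α : Type*} [MeasurableSpace α] {P : Measure α} {X Y : α → Pt} (hX : Measurable X)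
    (hY : Measurable Y) {μ ν : Measure Pt} (hXb : ∀ᵐ a ∂P, X a ∈ UHPbar)
    (hYb : ∀ᵐ a ∂P, Y a ∈ UHPbar)
    (h1 : (P.map X).restrict UHP = μ.restrict UHP) (h2 : (P.map Y).restrict UHP = ν.restrict UHP)
    {p : ℝ} (hp : 1 ≤ p) :
    OTe p μ ν ≤ ∫⁻ a, edist (X a) (Y a) ^ p ∂P := by
  refine (iInf₂_le _ (Adm_map hX hY hXb hYb h1 h2)).trans ?_
  rw [Cost_eq hp, lintegral_map (meas_edistp p) (hX.prodMk hY)]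

lemma OTe_self {p : ℝ} (hp : 1 ≤ p) {μ : Measure Pt} (h : MemMp p μ) : OTe p μ μ = 0 := by
  have hb : ∀ᵐ a ∂μ, id a ∈ UHPbar := by
    have : ∀ᵐ a ∂μ, a ∈ UHP := by rw [ae_iff]; exact h.1
    filter_upwards [this] with a ha using UHP_sub ha
  have := OTe_le (P := μ) (μ := μ) (ν := μ) measurable_id measurable_id hb hb (by simp) (by simp) hp
  simpa [show 0 < p by linarith] using this

lemma Adm_diag {p : ℝ} {μ : Measure Pt} (h : MemMp p μ) : ∃ π, π ∈ Adm μ μ := by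
  have hb : ∀ᵐ a ∂μ, id a ∈ UHPbar := by
    have : ∀ᵐ a ∂μ, a ∈ UHP := by rw [ae_iff]; exact h.1
    filter_upwards [this] with a ha using UHP_sub ha
  exact ⟨_, Adm_map (P := μ) measurable_id measurable_id hb hb (by simp) (by simp)⟩

lemma Adm_add {μ ν μ' ν' : Measure Pt} {π π' : Measure (Pt × Pt)} (h : π ∈ Adm μ ν)
    (h' : π' ∈ Adm μ' ν') : π + π' ∈ Adm (μ + μ') (ν + ν') := by
  refine ⟨by simp [h.1, h'.1], fun A hA hU => ?_, fun A hA hU => ?_⟩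
  · simp [h.2.1 A hA hU, h'.2.1 A hA hU]
  · simp [h.2.2 A hA hU, h'.2.2 A hA hU]

lemma OTe_add (p : ℝ) (μ ν μ' ν' : Measure Pt) :
    OTe p (μ + μ') (ν + ν') ≤ OTe p μ ν + OTe p μ' ν' := by
  unfold OTe
  simp only [iInf_subtype']
  refine ENNReal.le_iInf_add_iInf fun i j => ?_
  refine (iInf_le _ (⟨i.1 + j.1, Adm_add i.2 j.2⟩ : {π // π ∈ Adm (μ + μ') (ν + ν')})).trans ?_
  simp [Cost, lintegral_add_measure]

lemma OTe_symm (p : ℝ) (μ ν : Measure Pt) : OTe p μ ν = OTe p ν μ := by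
  have key : ∀ μ ν : Measure Pt, OTe p ν μ ≤ OTe p μ ν := by
    intro μ ν
    refine le_iInf₂ fun π hπ => ?_
    have hs : π.map Prod.swap ∈ Adm ν μ := by
      have := mem_Adm_iff.1 hπ
      exact Adm_map (P := π) measurable_snd measurable_fst (this.1.mono fun z h => h.2)
        (this.1.mono fun z h => h.1) this.2.2 this.2.1
    refine (iInf₂_le _ hs).trans ?_
    unfold Cost
    rw [lintegral_map (by fun_prop) measurable_swap]
    simp [dist_comm]
  exact le_antisymm (key _ _) (key _ _)

lemma ae_UHP {p : ℝ} {μ : Measure Pt} (h : MemMp p μ) : ∀ᵐ a ∂μ, a ∈ UHP := by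
  rw [ae_iff]; exact h.1

lemma Pers_eq' {p : ℝ} {μ : Measure Pt} (h : μ UHPᶜ = 0) : Pers p μ = ∫⁻ x, wt p x ∂μ := by
  rw [Pers_eq, restrict_UHP h]

lemma OTe_zero_le {p : ℝ} (hp : 1 ≤ p) {μ : Measure Pt} (h : μ UHPᶜ = 0) :
    OTe p μ 0 ≤ Pers p μ := by
  rw [Pers_eq' h]
  simp_rw [wt_eq hp]
  have hb : ∀ᵐ a ∂μ, id a ∈ UHPbar := by
    have : ∀ᵐ a ∂μ, a ∈ UHP := by rw [ae_iff]; exact h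
    filter_upwards [this] with a ha using UHP_sub ha
  refine OTe_le (P := μ) measurable_id meas_prj hb (ae_of_all _ fun a => Diag_sub (prj_mem a))
    (by simp) ?_ hp
  ext A hA
  rw [Measure.restrict_apply hA, Measure.map_apply meas_prj (hA.inter meas_UHP)]
  have : prj ⁻¹' (A ∩ UHP) = ∅ := by
    ext x; simp only [mem_preimage, mem_inter_iff, mem_empty_iff_false, iff_false, not_and]
    intro _ h; exact Diag_not (prj_mem x) h
  simp [this]

lemma OTe_ne_top {p : ℝ} (hp : 1 ≤ p) {μ ν : Measure Pt} (hμ : MemMp p μ) (hν : MemMp p ν) :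
    OTe p μ ν ≠ ⊤ := by
  have := OTe_add p μ 0 0 ν
  simp only [add_zero, zero_add] at this
  refine (this.trans_lt ?_).ne
  rw [OTe_symm p 0]
  exact ENNReal.add_lt_top.2 ⟨(OTe_zero_le hp hμ.1).trans_lt hμ.2, (OTe_zero_le hp hν.1).trans_lt hν.2⟩

lemma exists_plan {p : ℝ} {μ ν : Measure Pt} {c : ℝ≥0∞} (h : OTe p μ ν < c) :
    ∃ π ∈ Adm μ ν, Cost p π < c := by
  simpa [OTe, iInf_lt_iff] using h


lemma disint {p : ℝ} {μ ν : Measure Pt} (hμ : MemMp p μ) {π : Measure (Pt × Pt)}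
    (hπ : π ∈ Adm μ ν) :
    ∃ K : ProbabilityTheory.Kernel Pt Pt, ProbabilityTheory.IsMarkovKernel K ∧
      (∀ x, x ∉ UHP → K x = Measure.dirac x) ∧
      ∀ f : Pt × Pt → ℝ≥0∞, Measurable f →
        ∫⁻ z in Prod.fst ⁻¹' UHP, f z ∂π = ∫⁻ x in UHP, ∫⁻ y, f (x, y) ∂(K x) ∂μ := by
  set S : Set (Pt × Pt) := Prod.fst ⁻¹' UHP with hS
  have hSm : MeasurableSet S := measurable_fst meas_UHP
  have hwm : Measurable fun z : Pt × Pt => wt p z.1 := (meas_wt p).comp measurable_fst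
  set ρ : Measure (Pt × Pt) := (π.restrict S).withDensity (fun z => wt p z.1) with hρ
  have hfin : IsFiniteMeasure ρ := by
    constructor
    rw [hρ, withDensity_apply _ MeasurableSet.univ, Measure.restrict_univ,
      Adm_fst hπ (meas_wt p)]
    exact hμ.2
  have hfst : ρ.fst = (μ.restrict UHP).withDensity (wt p) := by
    ext A hA
    rw [Measure.fst_apply hA, hρ, withDensity_apply _ (measurable_fst hA), withDensity_apply _ hA,
      ← lintegral_indicator (measurable_fst hA), ← lintegral_indicator hA,
      ← Adm_fst hπ ((meas_wt p).indicator hA)]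
    rfl
  obtain ⟨κ, hκ, hdis⟩ : ∃ κ : ProbabilityTheory.Kernel Pt Pt,
      ProbabilityTheory.IsMarkovKernel κ ∧ ρ = ρ.fst.compProd κ :=
    ⟨ρ.condKernel, inferInstance, (ρ.disintegrate ρ.condKernel).symm⟩
  refine ⟨ProbabilityTheory.Kernel.piecewise meas_UHP κ ProbabilityTheory.Kernel.id,
    inferInstance, ?_, ?_⟩
  · intro x hx
    rw [ProbabilityTheory.Kernel.piecewise_apply, if_neg hx, ProbabilityTheory.Kernel.id_apply]
  · intro f hf
    have hfm : Measurable fun z : Pt × Pt => f z * (wt p z.1)⁻¹ := hf.mul hwm.inv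
    have h1 : ∫⁻ z in S, f z ∂π = ∫⁻ z, f z * (wt p z.1)⁻¹ ∂ρ := by
      rw [hρ, lintegral_withDensity_eq_lintegral_mul _ hwm hfm]
      refine setLIntegral_congr_fun hSm fun z hz => ?_
      simp only [Pi.mul_apply]
      rw [mul_comm (f z), ← mul_assoc, ENNReal.mul_inv_cancel (wt_pos hz) wt_top, one_mul]
    rw [h1, hdis, Measure.lintegral_compProd hfm, hfst,
      lintegral_withDensity_eq_lintegral_mul _ (meas_wt p) hfm.lintegral_kernel_prod_right]
    refine setLIntegral_congr_fun meas_UHP fun x hx => ?_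
    simp only [Pi.mul_apply]
    rw [ProbabilityTheory.Kernel.piecewise_apply, if_pos hx,
      lintegral_mul_const _ (by fun_prop : Measurable fun b => f (x, b)),
      mul_comm, mul_assoc, ENNReal.inv_mul_cancel (wt_pos hx) wt_top, mul_one]

open ProbabilityTheory in
lemma traj_step (K : ℕ → Kernel Pt Pt) [∀ n, IsMarkovKernel (K n)] :
    ∃ T : (m : ℕ) → Kernel (Pt × Pt) (ℕ → Pt), (∀ m, IsMarkovKernel (T m)) ∧
      (∀ m z, ∀ᵐ x ∂(T m z), (∀ n < m, x n = z.1) ∧ x m = z.2) ∧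
      (∀ m n z (f : Pt × Pt → ℝ≥0∞), Measurable f → m ≤ n →
        ∫⁻ x, f (x n, x (n+1)) ∂(T m z) = ∫⁻ x, ∫⁻ y, f (x n, y) ∂(K n (x n)) ∂(T m z)) := by
  let κ : (n : ℕ) → Kernel ((i : Finset.Iic n) → Pt) Pt :=
    fun n => (K n).comap (fun h => h ⟨n, Finset.mem_Iic.2 le_rfl⟩) (measurable_pi_apply _)
  have : ∀ n, IsMarkovKernel (κ n) := fun n => by dsimp [κ]; infer_instance
  let H : (m : ℕ) → Pt × Pt → ((i : Finset.Iic m) → Pt) := fun m z i => if i.1 = m then z.2 else z.1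
  have hH : ∀ m, Measurable (H m) := fun m => by
    refine measurable_pi_lambda _ fun i => ?_
    dsimp [H]; split_ifs <;> fun_prop
  refine ⟨fun m => (Kernel.traj (X := fun _ => Pt) κ m).comap (H m) (hH m),
    fun m => inferInstance, ?_, ?_⟩
  · intro m z
    rw [Kernel.comap_apply]
    have h1 := Kernel.traj_map_frestrictLe_apply (X := fun _ => Pt) (κ := κ) m m (H m z)
    rw [Kernel.partialTraj_self, Kernel.id_apply] at h1
    have h2 : ∀ᵐ h ∂((Kernel.traj (X := fun _ => Pt) κ m (H m z)).map
        (Preorder.frestrictLe m)), h = H m z := by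
      rw [h1]; simp [ae_dirac_eq]
    have h3 := ae_of_ae_map (by fun_prop) h2
    filter_upwards [h3] with x hx
    have h4 : ∀ i (hi : i ≤ m), x i = if i = m then z.2 else z.1 := fun i hi =>
      congrFun hx ⟨i, Finset.mem_Iic.2 hi⟩
    refine ⟨fun n hn => ?_, ?_⟩
    · rw [h4 n hn.le, if_neg hn.ne]
    · rw [h4 m le_rfl, if_pos rfl]
  · intro m n z f hf hmn
    rw [Kernel.comap_apply]
    have h1 := Kernel.partialTraj_compProd_eq_map_traj (X := fun _ => Pt) (κ := κ) hmn (x₀ := H m z)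
    have hfm : Measurable fun q : ((i : Finset.Iic n) → Pt) × Pt => f (q.1 ⟨n, Finset.mem_Iic.2 le_rfl⟩, q.2) := by
      fun_prop
    have h2 := lintegral_map (μ := Kernel.traj (X := fun _ => Pt) κ m (H m z)) hfm
      (g := fun x => (Preorder.frestrictLe n x, x (n+1))) (by fun_prop)
    refine h2.symm.trans ?_
    rw [← h1, Measure.lintegral_compProd hfm, ← Kernel.traj_map_frestrictLe_apply, lintegral_map
      hfm.lintegral_kernel_prod_right (by fun_prop)]
    rfl


lemma glue {p : ℝ} {μ : ℕ → Measure Pt} (hμ : ∀ n, MemMp p (μ n)) {π : ℕ → Measure (Pt × Pt)}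
    (hπ : ∀ n, π n ∈ Adm (μ n) (μ (n+1))) :
    ∃ P : Measure (ℕ → Pt),
      (∀ n, ((P.map fun x => x n).restrict UHP) = (μ n).restrict UHP) ∧
      (∀ᵐ x ∂P, ∀ n, x n ∈ UHPbar) ∧
      (∀ n (f : Pt × Pt → ℝ≥0∞), Measurable f → (∀ x, x ∉ UHP → f (x, x) = 0) →
        ∫⁻ x, f (x n, x (n+1)) ∂P ≤ ∫⁻ z, f z ∂(π n)) := by
  choose K hK hKd hKi using fun n => disint (hμ n) (hπ n)
  obtain ⟨T, hTm, hT1, hT2⟩ := traj_step K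
  set S : Set (Pt × Pt) := Prod.fst ⁻¹' UHPᶜ ∩ Prod.snd ⁻¹' UHP with hS
  have hSm : MeasurableSet S := (measurable_fst meas_UHP.compl).inter (measurable_snd meas_UHP)
  let b : ℕ → Measure (Pt × Pt) := fun m => Nat.casesOn m ((μ 0).map fun x => (x, x))
    (fun m => (π m).restrict S)
  have hb0 : b 0 = (μ 0).map fun x => (x, x) := rfl
  have hbs : ∀ m, b (m+1) = (π m).restrict S := fun m => rfl
  have hbS : ∀ m, 0 < m → ∀ᵐ z ∂(b m), z.1 ∉ UHP := by
    intro m hm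
    obtain ⟨m, rfl⟩ : ∃ k, m = k + 1 := ⟨m - 1, by omega⟩
    rw [hbs]
    filter_upwards [ae_restrict_mem hSm] with z hz using hz.1
  set P : Measure (ℕ → Pt) := Measure.sum fun m => (b m).bind (T m) with hP
  have hPi : ∀ F : (ℕ → Pt) → ℝ≥0∞, Measurable F →
      ∫⁻ x, F x ∂P = ∑' m, ∫⁻ z, ∫⁻ x, F x ∂(T m z) ∂(b m) := by
    intro F hF
    rw [hP, lintegral_sum_measure]
    congr 1; ext m
    rw [Measure.lintegral_bind (T m).measurable.aemeasurable hF.aemeasurable]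
  have hT0 : ∀ m n (g : Pt → ℝ≥0∞), (∀ x, x ∉ UHP → g x = 0) → n < m →
      ∫⁻ z, ∫⁻ x, g (x n) ∂(T m z) ∂(b m) = 0 := by
    intro m n g hg hnm
    rw [← lintegral_zero (μ := b m)]
    refine lintegral_congr_ae ?_
    filter_upwards [hbS m (by omega)] with z hz
    rw [← lintegral_zero (μ := T m z)]
    refine lintegral_congr_ae ?_
    filter_upwards [hT1 m z] with x hx
    rw [hx.1 n hnm, hg _ hz]
  have hA : ∀ n, (∀ g : Pt → ℝ≥0∞, Measurable g → (∀ x, x ∉ UHP → g x = 0) →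
        ∫⁻ x, g (x n) ∂P = ∫⁻ x in UHP, g x ∂(μ n)) →
      ∀ f : Pt × Pt → ℝ≥0∞, Measurable f → (∀ x, x ∉ UHP → f (x, x) = 0) →
        ∫⁻ x, f (x n, x (n+1)) ∂P =
          ∫⁻ z in Prod.fst ⁻¹' UHP, f z ∂(π n) + ∫⁻ z in S, f z ∂(π n) := by
    intro n hB f hf hf0
    set g : Pt → ℝ≥0∞ := fun x => ∫⁻ y, f (x, y) ∂(K n x) with hg
    have hgm : Measurable g := Measurable.lintegral_kernel_prod_right' hf
    have hg0 : ∀ x, x ∉ UHP → g x = 0 := by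
      intro x hx
      simp only [hg]
      rw [hKd n x hx, lintegral_dirac' _ (by fun_prop), hf0 x hx]
    rw [hKi n f hf, ← hB g hgm hg0, hPi _ (by fun_prop), hPi _ (by fun_prop),
      ← tsum_ite_eq (n + 1) (fun _ => ∫⁻ z in S, f z ∂(π n)), ← ENNReal.tsum_add]
    congr 1; ext m
    rcases lt_trichotomy m (n+1) with h | h | h
    · rw [if_neg h.ne, add_zero]
      refine lintegral_congr fun z => hT2 m n z f hf (by omega)
    · subst h
      rw [hT0 (n+1) n g hg0 (by omega), if_pos rfl, zero_add, hbs]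
      refine lintegral_congr fun z => ?_
      have : ∀ᵐ x ∂(T (n+1) z), f (x n, x (n+1)) = f z := by
        filter_upwards [hT1 (n+1) z] with x hx
        rw [hx.1 n (by omega), hx.2]
      rw [lintegral_congr_ae this]; simp
    · rw [if_neg h.ne', hT0 m n g hg0 (by omega), add_zero]
      rw [← lintegral_zero (μ := b m)]
      refine lintegral_congr_ae ?_
      filter_upwards [hbS m (by omega)] with z hz
      rw [← lintegral_zero (μ := T m z)]
      refine lintegral_congr_ae ?_
      filter_upwards [hT1 m z] with x hx
      rw [hx.1 n (by omega), hx.1 (n+1) (by omega), hf0 _ hz]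
  have hB : ∀ n, ∀ g : Pt → ℝ≥0∞, Measurable g → (∀ x, x ∉ UHP → g x = 0) →
        ∫⁻ x, g (x n) ∂P = ∫⁻ x in UHP, g x ∂(μ n) := by
    intro n
    induction n with
    | zero =>
      intro g hg hg0
      rw [hPi _ (by fun_prop), tsum_eq_single 0 (fun m hm => hT0 m 0 g hg0 (by omega)), hb0,
        lintegral_map _ (by fun_prop), restrict_UHP (hμ 0).1]
      · refine lintegral_congr fun z => ?_
        have : ∀ᵐ x ∂(T 0 (z, z)), g (x 0) = g z := by
          filter_upwards [hT1 0 (z, z)] with x hx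
          rw [hx.2]
        rw [lintegral_congr_ae this]; simp
      · exact Measurable.lintegral_kernel (by fun_prop)
    | succ n ih =>
      intro g hg hg0
      rw [hA n ih (fun z => g z.2) (by fun_prop) hg0, ← Adm_snd (hπ n) hg]
      have e : ∫⁻ z in Prod.fst ⁻¹' UHP, g z.2 ∂(π n) =
          ∫⁻ z in Prod.fst ⁻¹' UHP ∩ Prod.snd ⁻¹' UHP, g z.2 ∂(π n) := by
        rw [← lintegral_indicator (measurable_fst meas_UHP),
          ← lintegral_indicator ((measurable_fst meas_UHP).inter (measurable_snd meas_UHP))]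
        congr 1; ext z
        by_cases h1 : z.1 ∈ UHP <;> by_cases h2 : z.2 ∈ UHP <;>
          simp [indicator, h1, h2, hg0]
      rw [e, ← lintegral_union hSm]
      · congr 2
        ext z; by_cases h1 : z.1 ∈ UHP <;> simp [hS, h1]
      · rw [Set.disjoint_left]; rintro z hz hz'; exact hz'.1 hz.1
  have hC : ∀ n (f : Pt × Pt → ℝ≥0∞), Measurable f → (∀ x, x ∉ UHP → f (x, x) = 0) →
        ∫⁻ x, f (x n, x (n+1)) ∂P ≤ ∫⁻ z, f z ∂(π n) := by
    intro n f hf hf0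
    rw [hA n (hB n) f hf hf0, ← lintegral_union hSm]
    · exact setLIntegral_le_lintegral _ _
    · rw [Set.disjoint_left]; rintro z hz hz'; exact hz'.1 hz
  refine ⟨P, fun n => ?_, ?_, hC⟩
  · ext A hA
    have := hB n (indicator (A ∩ UHP) 1) (measurable_one.indicator (hA.inter meas_UHP)) (by
      intro x hx; simp [hx])
    have h2 : ∫⁻ x, (A ∩ UHP).indicator (1 : Pt → ℝ≥0∞) (x n) ∂P
        = ∫⁻ x, (A ∩ UHP).indicator (1 : Pt → ℝ≥0∞) x ∂(P.map fun x => x n) := by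
      rw [lintegral_map (measurable_one.indicator (hA.inter meas_UHP)) (by fun_prop)]
    rw [h2, lintegral_indicator_one (hA.inter meas_UHP), lintegral_indicator_one
      (hA.inter meas_UHP), Measure.restrict_apply (hA.inter meas_UHP)] at this
    rw [Measure.restrict_apply hA, Measure.restrict_apply hA, this, inter_assoc, inter_self]
  · -- support
    have h0 : ∀ᵐ x ∂P, x 0 ∈ UHPbar := by
      have hms : MeasurableSet {x : ℕ → Pt | x 0 ∈ UHPbar} :=
        (measurable_pi_apply 0) meas_UHPbar
      have hbz : ∀ m, ∀ᵐ z ∂(b m), z.1 ∈ UHPbar ∧ z.2 ∈ UHPbar := by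
        intro m
        cases m with
        | zero =>
          rw [hb0]
          refine (ae_map_iff (p := fun z : Pt × Pt => z.1 ∈ UHPbar ∧ z.2 ∈ UHPbar) (by fun_prop)
            ((measurable_fst meas_UHPbar).inter (measurable_snd meas_UHPbar))).2 ?_
          filter_upwards [ae_UHP (hμ 0)] with z hz using ⟨UHP_sub hz, UHP_sub hz⟩
        | succ m => 
          rw [hbs]
          exact ae_restrict_of_ae (mem_Adm_iff.1 (hπ m)).1
      have key : ∫⁻ x, (indicator {x : ℕ → Pt | x 0 ∈ UHPbar}ᶜ 1) x ∂P = 0 := by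
        rw [hPi _ (measurable_one.indicator hms.compl), ENNReal.tsum_eq_zero]
        intro m
        rw [← lintegral_zero (μ := b m)]
        refine lintegral_congr_ae ?_
        filter_upwards [hbz m] with z hz
        rw [← lintegral_zero (μ := T m z)]
        refine lintegral_congr_ae ?_
        filter_upwards [hT1 m z] with x hx
        have : x 0 ∈ UHPbar := by
          rcases Nat.eq_zero_or_pos m with rfl | h
          · rw [hx.2]; exact hz.2
          · rw [hx.1 0 h]; exact hz.1
        simp [this]
      rw [lintegral_indicator_one hms.compl] at key
      rw [ae_iff]; exact key
    have hs : ∀ n, ∀ᵐ x ∂P, x n = x (n+1) ∨ x (n+1) ∈ UHPbar := by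
      intro n
      let Q : Set (Pt × Pt) := {z | z.1 = z.2 ∨ z.2 ∈ UHPbar}
      have hQ : MeasurableSet Q :=
        (measurableSet_eq_fun measurable_fst measurable_snd).union (measurable_snd meas_UHPbar)
      have := hC n (indicator Qᶜ 1) (measurable_one.indicator hQ.compl) (by
        intro x hx; simp [Q])
      have hz : ∫⁻ z, (indicator Qᶜ 1) z ∂(π n) = 0 := by
        rw [lintegral_indicator_one hQ.compl]
        have := (mem_Adm_iff.1 (hπ n)).1
        have h2 : ∀ᵐ z ∂(π n), z ∈ Q := this.mono fun z hz => Or.inr hz.2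
        exact h2
      rw [hz, nonpos_iff_eq_zero] at this
      have h3 : ∀ᵐ x ∂P, (x n, x (n+1)) ∈ Q := by
        have hms : MeasurableSet {x : ℕ → Pt | (x n, x (n+1)) ∈ Q} := by
          have : Measurable fun x : ℕ → Pt => (x n, x (n+1)) := by fun_prop
          exact this hQ
        rw [ae_iff]
        refine Eq.trans ?_ this
        exact (lintegral_indicator_one hms.compl).symm
      exact h3
    rw [← ae_all_iff] at hs
    filter_upwards [h0, hs] with x hx0 hxs n
    induction n with
    | zero => exact hx0
    | succ n ih => 
      rcases hxs n with h | h
      · rw [← h]; exact ih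
      · exact h


lemma OT_le_eLp {α : Type*} [MeasurableSpace α] {P : Measure α} {X Y : α → Pt} (hX : Measurable X)
    (hY : Measurable Y) {μ ν : Measure Pt} (hXb : ∀ᵐ a ∂P, X a ∈ UHPbar)
    (hYb : ∀ᵐ a ∂P, Y a ∈ UHPbar)
    (h1 : (P.map X).restrict UHP = μ.restrict UHP) (h2 : (P.map Y).restrict UHP = ν.restrict UHP)
    {p : ℝ} (hp : 1 ≤ p) :
    OTe p μ ν ^ (1 / p) ≤ eLpNorm' (fun a => X a - Y a) p P := by
  unfold eLpNorm'
  refine ENNReal.rpow_le_rpow ?_ (by positivity)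
  simp_rw [← edist_eq_enorm_sub]
  exact OTe_le hX hY hXb hYb h1 h2 hp

lemma glue' {p : ℝ} (hp : 1 ≤ p) {μ : ℕ → Measure Pt} (hμ : ∀ n, MemMp p (μ n))
    {π : ℕ → Measure (Pt × Pt)} (hπ : ∀ n, π n ∈ Adm (μ n) (μ (n+1))) :
    ∃ P : Measure (ℕ → Pt),
      (∀ n, ((P.map fun x => x n).restrict UHP) = (μ n).restrict UHP) ∧
      (∀ᵐ x ∂P, ∀ n, x n ∈ UHPbar) ∧
      (∀ n, eLpNorm' (fun x => x n - x (n+1)) p P ≤ Cost p (π n) ^ (1 / p)) := by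
  obtain ⟨P, h1, h2, h3⟩ := glue hμ hπ
  refine ⟨P, h1, h2, fun n => ?_⟩
  unfold eLpNorm'
  refine ENNReal.rpow_le_rpow ?_ (by positivity)
  simp_rw [← edist_eq_enorm_sub]
  rw [Cost_eq hp]
  exact h3 n (fun z => edist z.1 z.2 ^ p) (meas_edistp p) (by simp; intros; linarith)

lemma OT_triangle {p : ℝ} (hp : 1 ≤ p) {μ ν l : Measure Pt} (hμ : MemMp p μ) (hν : MemMp p ν)
    (hl : MemMp p l) :
    OTe p μ l ^ (1 / p) ≤ OTe p μ ν ^ (1 / p) + OTe p ν l ^ (1 / p) := by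
  have hp0 : 0 < p := by linarith
  have key : ∀ π1 ∈ Adm μ ν, ∀ π2 ∈ Adm ν l,
      OTe p μ l ^ (1 / p) ≤ Cost p π1 ^ (1 / p) + Cost p π2 ^ (1 / p) := by
    intro π1 h1 π2 h2
    obtain ⟨π3, h3⟩ := Adm_diag hl
    let m : ℕ → Measure Pt := fun n => match n with
      | 0 => μ
      | 1 => ν
      | _ + 2 => l
    let π : ℕ → Measure (Pt × Pt) := fun n => match n with
      | 0 => π1
      | 1 => π2
      | _ + 2 => π3
    obtain ⟨P, hP1, hP2, hP3⟩ := glue' hp (μ := m) (π := π)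
      (by intro n; match n with
        | 0 => exact hμ
        | 1 => exact hν
        | _ + 2 => exact hl)
      (by intro n; match n with
        | 0 => exact h1
        | 1 => exact h2
        | _ + 2 => exact h3)
    have hc := OT_le_eLp (P := P) (X := fun x => x 0) (Y := fun x => x 2) (by fun_prop)
      (by fun_prop) (hP2.mono fun x h => h 0) (hP2.mono fun x h => h 2) (hP1 0) (hP1 2) hp
    refine hc.trans ?_
    have e : (fun x : ℕ → Pt => x 0 - x 2) = (fun x => x 0 - x 1) + (fun x => x 1 - x 2) := by
      ext x; simp
    rw [e]
    refine (eLpNorm'_add_le (by fun_prop) (by fun_prop) hp).trans ?_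
    exact add_le_add (hP3 0) (hP3 1)
  have e : ∀ μ ν, OTe p μ ν ^ (1 / p) = ⨅ π : Adm μ ν, Cost p π.1 ^ (1 / p) := by
    intro μ ν
    unfold OTe
    rw [iInf_subtype']
    have := (ENNReal.orderIsoRpow (1/p) (by positivity)).map_iInf
      (fun π : Adm μ ν => Cost p π.1)
    exact this
  rw [e μ ν, e ν l]
  exact ENNReal.le_iInf_add_iInf fun i j => key _ i.2 _ j.2

lemma fin_level {p : ℝ} (hp : 1 ≤ p) {μ : Measure Pt} (hμ : MemMp p μ) {ε : ℝ} (hε : 0 < ε) :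
    μ {x | ε ≤ persDist x} ≠ ⊤ := by
  have hp0 : 0 < p := by linarith
  have h1 : ENNReal.ofReal (ε ^ p) * μ {x | ENNReal.ofReal (ε ^ p) ≤ wt p x} ≤ ∫⁻ x, wt p x ∂μ :=
    mul_meas_ge_le_lintegral (meas_wt p) _
  rw [← Pers_eq' hμ.1] at h1
  have h2 : μ {x | ENNReal.ofReal (ε ^ p) ≤ wt p x} ≠ ⊤ := by
    intro h
    rw [h, ENNReal.mul_top (by simpa using Real.rpow_pos_of_pos hε p)] at h1
    exact absurd hμ.2 (by simp [top_le_iff.1 h1])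
  refine ne_top_of_le_ne_top h2 (measure_mono fun x hx => ?_)
  exact ENNReal.ofReal_le_ofReal (Real.rpow_le_rpow hε.le hx hp0.le)

lemma closed_le {p : ℝ} (hp : 1 ≤ p) {μ ν : Measure Pt} (hν : MemMp p ν)
    (h : OTe p μ ν = 0) {F : Set Pt} (hF : IsClosed F) {ε : ℝ} (hε : 0 < ε)
    (hFε : ∀ x ∈ F, ε ≤ persDist x) (hFU : F ⊆ UHP) : μ F ≤ ν F := by
  have hp0 : 0 < p := by linarith
  -- persDist is 1-Lipschitz
  have hlev : ∀ δ, δ ≤ ε / 2 → cthickening δ F ⊆ {x | ε / 2 ≤ persDist x} := by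
    intro δ hδ
    have hcl : IsClosed {x | ε / 2 ≤ persDist x} := isClosed_le continuous_const cont_persDist
    intro x hx
    rw [mem_ofPred_eq]
    by_contra hlt
    push Not at hlt
    set η := ε / 2 - persDist x
    have hη : 0 < η := by simp only [η]; linarith
    have hx' : x ∈ thickening (ε / 2 + η) F :=
      cthickening_subset_thickening' (by linarith) (by linarith) F hx
    obtain ⟨y, hy, hxy⟩ := mem_thickening_iff.1 hx'
    have h1 := hFε y hy
    have h2 : persDist y ≤ persDist x + dist y x := infDist_le_infDist_add_dist
    rw [dist_comm] at h2
    simp only [η] at hxy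
    linarith
  have step : ∀ δ, 0 < δ → δ ≤ ε / 2 → μ F ≤ ν (cthickening δ F) := by
    intro δ hδ hδ2
    refine ENNReal.le_of_forall_pos_le_add fun r hr _ => ?_
    have hpos : 0 < (r : ℝ≥0∞) * ENNReal.ofReal δ ^ p := by
      have : ENNReal.ofReal δ ^ p ≠ 0 := by
        simp [hδ, hp0]
      refine pos_iff_ne_zero.2 (mul_ne_zero (by exact_mod_cast hr.ne') this)
    obtain ⟨π, hπ, hc⟩ := exists_plan (h ▸ hpos : OTe p μ ν < _)
    have hcm : MeasurableSet (cthickening δ F) := isClosed_cthickening.measurableSet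
    have hbd : ∀ᵐ z ∂π, z ∈ F ×ˢ (univ : Set Pt) →
        z ∈ ((univ : Set Pt) ×ˢ (cthickening δ F ∩ UHP)) ∪ {z | ENNReal.ofReal δ ^ p ≤ edist z.1 z.2 ^ p} := by
      filter_upwards [(mem_Adm_iff.1 hπ).1] with z hz hzF
      by_cases hd : dist z.1 z.2 ≤ δ
      · left
        have hzc : z.2 ∈ cthickening δ F :=
          mem_cthickening_of_dist_le z.2 z.1 δ F hzF.1 (by rwa [dist_comm])
        refine ⟨mem_univ _, hzc, ?_⟩
        by_contra hU
        have h3 := hlev δ hδ2 hzc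
        rw [mem_ofPred_eq, persDist_diag (bar_not hz.2 hU)] at h3
        linarith
      · right
        rw [mem_ofPred_eq, edist_dist]
        gcongr
        exact (not_le.1 hd).le
    have h1 : μ F = π (F ×ˢ univ) := (hπ.2.1 F hF.measurableSet hFU).symm
    rw [h1]
    refine (measure_mono_ae hbd).trans ((measure_union_le _ _).trans (add_le_add ?_ ?_))
    · rw [hπ.2.2 _ (hcm.inter meas_UHP) inter_subset_right]
      exact measure_mono inter_subset_left
    · have h4 := (mul_meas_ge_le_lintegral (μ := π) (meas_edistp p) (ENNReal.ofReal δ ^ p))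
      rw [← Cost_eq hp, mul_comm] at h4
      have h5 := h4.trans hc.le
      refine (ENNReal.mul_le_mul_iff_left ?_ ?_).1 h5
      · simp [hδ, hp0]
      · simp [hp0.le]
  have ht : Tendsto (fun δ => ν (cthickening δ F)) (𝓝 0) (𝓝 (ν F)) := by
    refine tendsto_measure_cthickening_of_isClosed ⟨ε / 2, by linarith, ?_⟩ hF
    exact ne_top_of_le_ne_top (fin_level hp hν (half_pos hε)) (measure_mono (hlev _ le_rfl))
  have ht' : Tendsto (fun δ => ν (cthickening δ F)) (𝓝[>] 0) (𝓝 (ν F)) :=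
    ht.mono_left nhdsWithin_le_nhds
  refine ge_of_tendsto ht' ?_
  filter_upwards [Ioc_mem_nhdsGT (half_pos hε)] with δ hδ using step δ hδ.1 hδ.2

lemma eq_of_OTe_zero {p : ℝ} (hp : 1 ≤ p) {μ ν : Measure Pt} (hμ : MemMp p μ) (hν : MemMp p ν)
    (h : OTe p μ ν = 0) : μ = ν := by
  let L : ℕ → Set Pt := fun n => UHPbar ∩ {x | 1 / ((n : ℝ) + 1) ≤ persDist x}
  have hLc : ∀ n, IsClosed (L n) := fun n =>
    isClosed_UHPbar.inter (isClosed_le continuous_const cont_persDist)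
  have hLU : ∀ n, L n ⊆ UHP := by
    intro n x hx
    by_contra hU
    have h3 := hx.2
    rw [mem_ofPred_eq, persDist_diag (bar_not hx.1 hU)] at h3
    have : (0 : ℝ) < 1 / ((n : ℝ) + 1) := by positivity
    linarith
  have hres : ∀ n, μ.restrict (L n) = ν.restrict (L n) := by
    intro n
    have hε : (0 : ℝ) < 1 / ((n : ℝ) + 1) := by positivity
    have f1 : IsFiniteMeasure (μ.restrict (L n)) := ⟨by
      rw [Measure.restrict_apply_univ]
      exact (measure_mono inter_subset_right).trans_lt (fin_level hp hμ hε).lt_top⟩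
    have hcl : ∀ F, IsClosed F → μ.restrict (L n) F = ν.restrict (L n) F := by
      intro F hF
      rw [Measure.restrict_apply hF.measurableSet, Measure.restrict_apply hF.measurableSet]
      have hF' := hF.inter (hLc n)
      apply le_antisymm
      · exact closed_le hp hν h hF' hε (fun x hx => hx.2.2) (inter_subset_right.trans (hLU n))
      · exact closed_le hp hμ (OTe_symm p μ ν ▸ h) hF' hε (fun x hx => hx.2.2)
          (inter_subset_right.trans (hLU n))
    refine ext_of_generate_finite {s : Set Pt | IsClosed s} ?_ isPiSystem_isClosed
      (fun s hs => hcl s hs) (hcl univ isClosed_univ)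
    rw [BorelSpace.measurable_eq (α := Pt), borel_eq_generateFrom_isClosed]
  have hun : ⋃ n, L n = UHP := by
    apply subset_antisymm (iUnion_subset hLU)
    intro x hx
    obtain ⟨n, hn⟩ := exists_nat_one_div_lt (persDist_pos hx)
    exact mem_iUnion.2 ⟨n, UHP_sub hx, hn.le⟩
  rw [← restrict_UHP hμ.1, ← restrict_UHP hν.1, ← hun]
  exact Measure.restrict_iUnion_congr.2 hres


lemma OT_complete {p : ℝ} (hp : 1 ≤ p) {u : ℕ → Measure Pt} (hu : ∀ n, MemMp p (u n))
    (h : ∀ n, OTe p (u n) (u (n+1)) ^ (1 / p) < (2⁻¹ : ℝ≥0∞) ^ n) :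
    ∃ μ, MemMp p μ ∧ Tendsto (fun n => OTe p (u n) μ ^ (1 / p)) atTop (𝓝 0) := by
  have hp0 : 0 < p := by linarith
  have hex : ∀ n, ∃ π ∈ Adm (u n) (u (n+1)), Cost p π ^ (1 / p) ≤ (2⁻¹ : ℝ≥0∞) ^ n := by
    intro n
    have h1 : OTe p (u n) (u (n+1)) < ((2⁻¹ : ℝ≥0∞) ^ n) ^ p := by
      have := ENNReal.rpow_lt_rpow (h n) hp0
      rwa [← ENNReal.rpow_mul, one_div, inv_mul_cancel₀ hp0.ne', ENNReal.rpow_one] at this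
    obtain ⟨π, hπ, hc⟩ := exists_plan h1
    refine ⟨π, hπ, ?_⟩
    have := ENNReal.rpow_le_rpow hc.le (by positivity : 0 ≤ 1 / p)
    rw [← ENNReal.rpow_mul, mul_one_div_cancel hp0.ne', ENNReal.rpow_one] at this
    exact this
  choose π hπ hc using hex
  obtain ⟨P, hP1, hP2, hP3⟩ := glue' hp hu hπ
  have hstep : ∀ n, eLpNorm' (fun x => x n - x (n+1)) p P ≤ (2⁻¹ : ℝ≥0∞) ^ n :=
    fun n => (hP3 n).trans (hc n)
  have hsum : ∀ n k, eLpNorm' (fun x => x n - x (n+k)) p P ≤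
      ∑ j ∈ Finset.range k, (2⁻¹ : ℝ≥0∞) ^ (n + j) := by
    intro n k
    induction k with
    | zero => 
      simp only [add_zero, sub_self, Finset.range_zero, Finset.sum_empty]
      exact (eLpNorm'_zero hp0).le
    | succ k ih =>
      rw [Finset.sum_range_succ]
      have e : (fun x : ℕ → Pt => x n - x (n + (k+1))) =
          (fun x => x n - x (n+k)) + (fun x => x (n+k) - x (n+k+1)) := by
        ext x; simp [add_assoc]
      rw [e]
      exact (eLpNorm'_add_le (by fun_prop) (by fun_prop) hp).trans (add_le_add ih (hstep _))
  have hbd : ∀ n m, n ≤ m → eLpNorm' (fun x => x n - x m) p P ≤ (2⁻¹ : ℝ≥0∞) ^ n * 2 := by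
    intro n m hnm
    obtain ⟨k, rfl⟩ := Nat.exists_eq_add_of_le hnm
    refine (hsum n k).trans ((ENNReal.sum_le_tsum _).trans ?_)
    simp_rw [pow_add, ENNReal.tsum_mul_left, ENNReal.tsum_geometric, ENNReal.one_sub_inv_two, inv_inv]
    exact le_rfl
  have hcau : ∀ N n m : ℕ, N ≤ n → N ≤ m →
      eLpNorm' ((fun x : ℕ → Pt => x n) - fun x => x m) p P < (2⁻¹ : ℝ≥0∞) ^ N * 3 := by
    have base : ∀ N n m : ℕ, N ≤ n → n ≤ m →
        eLpNorm' ((fun x : ℕ → Pt => x n) - fun x => x m) p P < (2⁻¹ : ℝ≥0∞) ^ N * 3 := by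
      intro N n m h1 h2
      refine (hbd n m h2).trans_lt ?_
      calc (2⁻¹ : ℝ≥0∞) ^ n * 2 ≤ (2⁻¹ : ℝ≥0∞) ^ N * 2 := by
            gcongr ?_ * _
            exact pow_le_pow_right_of_le_one' (by simp) h1
        _ < _ := by
            refine (ENNReal.mul_lt_mul_iff_right ?_ ?_).2 (by norm_num)
            · simp
            · simp
    intro N n m h1 h2
    rcases le_total n m with h3 | h3
    · exact base N n m h1 h3
    · have : ((fun x : ℕ → Pt => x n) - fun x => x m) = -((fun x : ℕ → Pt => x m) - fun x => x n) := by
        simp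
      rw [this, eLpNorm'_neg]
      exact base N m n h2 h3
  have hB : ∑' N : ℕ, (2⁻¹ : ℝ≥0∞) ^ N * 3 ≠ ⊤ := by
    rw [ENNReal.tsum_mul_right, ENNReal.tsum_geometric, ENNReal.one_sub_inv_two, inv_inv]
    exact ENNReal.mul_ne_top (by simp) (by simp)
  have hconv := Lp.ae_tendsto_of_cauchy_eLpNorm' (μ := P) (f := fun n (x : ℕ → Pt) => x n)
    (fun n => (measurable_pi_apply n).aestronglyMeasurable) hp hB hcau
  obtain ⟨X, hX, hXl⟩ := measurable_limit_of_tendsto_metrizable_ae (μ := P) (L := atTop)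
    (f := fun n (x : ℕ → Pt) => x n) (fun n => (measurable_pi_apply n).aemeasurable) hconv
  have hlim : ∀ n, eLpNorm' (fun x => x n - X x) p P ≤ (2⁻¹ : ℝ≥0∞) ^ n * 2 := by
    intro n
    refine (Lp.eLpNorm'_lim_le_liminf_eLpNorm' hp0 (f := fun m (x : ℕ → Pt) => x n - x m)
      (fun m => by fun_prop) (f_lim := fun x => x n - X x) ?_).trans ?_
    · filter_upwards [hXl] with x hx
      exact tendsto_const_nhds.sub hx
    · refine (liminf_le_liminf ?_).trans (liminf_const _).le
      filter_upwards [eventually_ge_atTop n] with m hm using hbd n m hm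
  have hXb : ∀ᵐ x ∂P, X x ∈ UHPbar := by
    filter_upwards [hXl, hP2] with x hx hxb
    exact isClosed_UHPbar.mem_of_tendsto hx (Eventually.of_forall hxb)
  set μ := (P.map X).restrict UHP with hμ
  refine ⟨μ, ⟨?_, ?_⟩, ?_⟩
  · rw [hμ, Measure.restrict_apply meas_UHP.compl]; simp
  · -- finite persistence
    have hw : ∀ x, wt p x = ENNReal.ofReal (persDist x) ^ p := fun x => by
      rw [wt, ENNReal.ofReal_rpow_of_nonneg (persDist_nonneg x) hp0.le]
    have h1 : Pers p μ ≤ ∫⁻ x, wt p (X x) ∂P := by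
      rw [Pers_eq, hμ, Measure.restrict_restrict meas_UHP, inter_self]
      refine (setLIntegral_le_lintegral _ _).trans ?_
      rw [lintegral_map (meas_wt p) hX]
    have h0 : ∫⁻ x, wt p (x 0) ∂P = Pers p (u 0) := by
      rw [Pers_eq, ← hP1 0, Measure.restrict_map (by fun_prop) meas_UHP,
        lintegral_map (meas_wt p) (by fun_prop),
        ← lintegral_indicator ((measurable_pi_apply 0) meas_UHP)]
      refine lintegral_congr_ae ?_
      filter_upwards [hP2] with x hx
      by_cases hxU : x 0 ∈ UHP
      · simp [indicator, hxU]
      · have : wt p (x 0) = 0 := by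
          rw [wt, persDist_diag (bar_not (hx 0) hxU), Real.zero_rpow hp0.ne']; simp
        simp [indicator, hxU, this]
    have hpm : Measurable fun x => ENNReal.ofReal (persDist x) :=
      cont_persDist.measurable.ennreal_ofReal
    have h2 : (∫⁻ x, wt p (X x) ∂P) ^ (1 / p) ≤
        (∫⁻ x, wt p (x 0) ∂P) ^ (1 / p) + eLpNorm' (fun x => x 0 - X x) p P := by
      have := ENNReal.lintegral_Lp_add_le (μ := P) (p := p)
        (f := fun x => ENNReal.ofReal (persDist (x 0))) (g := fun x => ‖x 0 - X x‖ₑ)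
        (hpm.comp (measurable_pi_apply 0)).aemeasurable (by fun_prop) hp
      simp_rw [hw]
      refine le_trans ?_ this
      gcongr with x
      simp only [Pi.add_apply]
      rw [← edist_eq_enorm_sub, edist_comm, edist_dist, ← ENNReal.ofReal_add (persDist_nonneg _) dist_nonneg]
      exact ENNReal.ofReal_le_ofReal infDist_le_infDist_add_dist
    have h3 : (∫⁻ x, wt p (X x) ∂P) ^ (1 / p) < ⊤ := by
      refine h2.trans_lt (ENNReal.add_lt_top.2 ⟨?_, (hlim 0).trans_lt (by simp)⟩)
      rw [h0]
      exact ENNReal.rpow_lt_top_of_nonneg (by positivity) (hu 0).2.ne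
    refine h1.trans_lt ?_
    by_contra hcon
    rw [not_lt, top_le_iff] at hcon
    rw [hcon, ENNReal.top_rpow_of_pos (by positivity)] at h3
    exact lt_irrefl _ h3
  · have hle : ∀ n, OTe p (u n) μ ^ (1 / p) ≤ (2⁻¹ : ℝ≥0∞) ^ n * 2 := by
      intro n
      refine (OT_le_eLp (P := P) (X := fun x => x n) (Y := X) (by fun_prop) hX
        (hP2.mono fun x h => h n) hXb (hP1 n) ?_ hp).trans (hlim n)
      rw [hμ, Measure.restrict_restrict meas_UHP, inter_self]
    refine tendsto_of_tendsto_of_tendsto_of_le_of_le tendsto_const_nhds ?_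
      (fun n => zero_le) hle
    have := ENNReal.Tendsto.mul_const (b := 2) (ENNReal.tendsto_pow_atTop_nhds_zero_of_lt_one
      (r := 2⁻¹) (by simp)) (Or.inr (by simp))
    simpa using this


lemma MemMp_zero (p : ℝ) : MemMp p (0 : Measure Pt) := ⟨by simp, by simp [Pers]⟩

lemma piece {p : ℝ} (hp : 1 ≤ p) {ν : Measure Pt} (hν : ν UHPᶜ = 0) (hfin : ν univ ≠ ⊤) {x : Pt}
    (hx : x ∈ UHP) {η : ℝ} (h0 : 0 < η) (h : ∀ᵐ y ∂ν, dist y x ≤ η * persDist y) :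
    ∃ q : ℚ, OTe p ν (ENNReal.ofReal q • Measure.dirac x) ≤
      (ENNReal.ofReal η ^ p + ENNReal.ofReal η) * ∫⁻ y, wt p y ∂ν := by
  have hp0 : 0 < p := by linarith
  by_cases hc : ν univ = 0
  · have : ν = 0 := Measure.measure_univ_eq_zero.1 hc
    subst this
    refine ⟨0, ?_⟩
    simp [OTe_self hp (MemMp_zero p)]
  set c := (ν univ).toReal with hcdef
  have hcpos : 0 < c := ENNReal.toReal_pos hc hfin
  obtain ⟨q, hq1, hq2⟩ := exists_rat_btwn (show max 0 ((1 - η) * c) < c from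
    max_lt hcpos (by nlinarith))
  have hq0 : (0:ℝ) < q := (le_max_left _ _).trans_lt hq1
  have hq3 : (1 - η) * c < q := (le_max_right _ _).trans_lt hq1
  set t := (q : ℝ) / c with ht
  have ht0 : 0 < t := by positivity
  have ht1 : t < 1 := (div_lt_one hcpos).2 hq2
  have ht2 : 1 - t ≤ η := by
    have : 1 - η < t := (lt_div_iff₀ hcpos).2 hq3
    linarith
  have hb : ∀ᵐ a ∂ν, a ∈ UHPbar := by
    have : ∀ᵐ a ∂ν, a ∈ UHP := by rw [ae_iff]; exact hν
    filter_upwards [this] with a ha using UHP_sub ha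
  refine ⟨q, ?_⟩
  have hsplit : ν = ENNReal.ofReal t • ν + ENNReal.ofReal (1 - t) • ν := by
    rw [← add_smul, ← ENNReal.ofReal_add ht0.le (by linarith)]
    simp
  have h1 : OTe p (ENNReal.ofReal t • ν) (ENNReal.ofReal q • Measure.dirac x) ≤
      ENNReal.ofReal η ^ p * ∫⁻ y, wt p y ∂ν := by
    refine (OTe_le (P := ENNReal.ofReal t • ν) (X := fun y => y) (Y := fun _ => x) measurable_id
      measurable_const (Measure.ae_smul_measure hb _) (ae_of_all _ fun _ => UHP_sub hx)
      (by congr 1; exact Measure.map_id) ?_ hp).trans ?_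
    · congr 1
      rw [Measure.map_const, Measure.smul_apply, smul_eq_mul]
      congr 1
      rw [← ENNReal.ofReal_toReal hfin, ← ENNReal.ofReal_mul ht0.le, ← hcdef, ht,
        div_mul_cancel₀ _ hcpos.ne']
    · rw [lintegral_smul_measure, smul_eq_mul, ← lintegral_const_mul _ (meas_wt p)]
      refine (mul_le_of_le_one_left (zero_le) (by simpa using ht1.le)).trans ?_
      refine lintegral_mono_ae ?_
      filter_upwards [h] with y hy
      rw [wt, ← ENNReal.ofReal_rpow_of_nonneg (persDist_nonneg y) hp0.le,
        ← ENNReal.mul_rpow_of_nonneg _ _ hp0.le, ← ENNReal.ofReal_mul h0.le, edist_dist]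
      exact ENNReal.rpow_le_rpow (ENNReal.ofReal_le_ofReal hy) hp0.le
  have hz : (ENNReal.ofReal (1 - t) • ν) UHPᶜ = 0 := by simp [hν]
  have h2 : OTe p (ENNReal.ofReal (1 - t) • ν) 0 ≤ ENNReal.ofReal η * ∫⁻ y, wt p y ∂ν := by
    refine (OTe_zero_le hp hz).trans ?_
    rw [Pers_eq' hz, lintegral_smul_measure, smul_eq_mul]
    gcongr
  have h3 := OTe_add p (ENNReal.ofReal t • ν) (ENNReal.ofReal q • Measure.dirac x)
    (ENNReal.ofReal (1 - t) • ν) 0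
  rw [← hsplit, add_zero] at h3
  rw [add_mul]
  exact h3.trans (add_le_add h1 h2)

lemma approx {p : ℝ} (hp : 1 ≤ p) {μ : Measure Pt} (hμ : MemMp p μ) {x : ℕ → Pt}
    (hx : ∀ i, x i ∈ UHP) (hd : ∀ y ∈ UHP, ∀ ε > 0, ∃ i, dist y (x i) < ε) {ε : ℝ≥0∞} (hε : ε ≠ 0) :
    ∃ (N : ℕ) (q : Fin N → ℚ), OTe p μ (∑ i, ENNReal.ofReal (q i) • Measure.dirac (x i)) < ε := by
  have hp0 : 0 < p := by linarith
  have hW : ∫⁻ y, wt p y ∂μ ≠ ⊤ := by rw [← Pers_eq' hμ.1]; exact hμ.2.ne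
  obtain ⟨η, hη, hηK⟩ : ∃ η : ℝ, 0 < η ∧
      (ENNReal.ofReal η ^ p + ENNReal.ofReal η) * ∫⁻ y, wt p y ∂μ < ε / 2 := by
    have hc : Tendsto (fun η : ℝ => (ENNReal.ofReal η ^ p + ENNReal.ofReal η) * ∫⁻ y, wt p y ∂μ)
        (𝓝 0) (𝓝 ((ENNReal.ofReal 0 ^ p + ENNReal.ofReal 0) * ∫⁻ y, wt p y ∂μ)) := by
      refine ENNReal.Tendsto.mul_const ?_ (Or.inr hW)
      have hco : Continuous fun η : ℝ => ENNReal.ofReal η ^ p + ENNReal.ofReal η := by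
        have := ENNReal.continuous_rpow_const (y := p)
        exact (this.comp ENNReal.continuous_ofReal).add ENNReal.continuous_ofReal
      exact hco.tendsto 0
    have hz : (ENNReal.ofReal 0 ^ p + ENNReal.ofReal 0) * ∫⁻ y, wt p y ∂μ < ε / 2 := by
      simp [hp0, ENNReal.zero_rpow_of_pos, pos_iff_ne_zero, hε]
    have := ((hc.eventually (gt_mem_nhds hz)).filter_mono nhdsWithin_le_nhds :
      ∀ᶠ η in 𝓝[>] (0:ℝ), _)
    obtain ⟨η, h1, h2⟩ := (this.and self_mem_nhdsWithin).exists
    exact ⟨η, h2, h1⟩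
  set K := ENNReal.ofReal η ^ p + ENNReal.ofReal η with hK
  let B : ℕ → Set Pt := fun i => UHP ∩ {y | dist y (x i) < η * persDist y}
  have hBm : ∀ i, MeasurableSet (B i) := fun i =>
    meas_UHP.inter (isOpen_lt (by fun_prop) (continuous_const.mul cont_persDist)).measurableSet
  let U : ℕ → Set Pt := fun N => ⋃ i ∈ Finset.range N, B i
  have hUm : ∀ N, MeasurableSet (U N) := fun N => Finset.measurableSet_biUnion _ fun i _ => hBm i
  have hUs : ∀ N, U (N+1) = U N ∪ (B N \ U N) := by
    intro N
    rw [union_sdiff_self]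
    simp only [U]
    rw [Finset.range_add_one, Finset.set_biUnion_insert, union_comm]
  have hq : ∀ i, ∃ q : ℚ, OTe p (μ.restrict (B i \ U i)) (ENNReal.ofReal q • Measure.dirac (x i)) ≤
      K * ∫⁻ y in B i \ U i, wt p y ∂μ := by
    intro i
    refine piece hp ?_ ?_ (hx i) hη ?_
    · exact le_antisymm ((Measure.restrict_le_self _).trans hμ.1.le) (zero_le)
    · rw [Measure.restrict_apply_univ]
      have hpos : 0 < persDist (x i) / (1 + η) := div_pos (persDist_pos (hx i)) (by linarith)
      refine ne_top_of_le_ne_top (fin_level hp hμ hpos) (measure_mono ?_)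
      rintro y ⟨⟨_, hy⟩, _⟩
      have hy' : dist y (x i) < η * persDist y := hy
      have : persDist (x i) ≤ persDist y + dist (x i) y := infDist_le_infDist_add_dist
      rw [dist_comm] at this
      show persDist (x i) / (1 + η) ≤ persDist y
      rw [div_le_iff₀ (by linarith)]
      linarith
    · filter_upwards [ae_restrict_mem ((hBm i).diff (hUm i))] with y hy
      exact le_of_lt hy.1.2
  choose q hq using hq
  have hind : ∀ N, OTe p (μ.restrict (U N))
      (∑ i ∈ Finset.range N, ENNReal.ofReal (q i) • Measure.dirac (x i)) ≤
      K * ∫⁻ y in U N, wt p y ∂μ := by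
    intro N
    induction N with
    | zero => simp [U, OTe_self hp (MemMp_zero p)]
    | succ N ih =>
      rw [hUs, Finset.sum_range_succ, Measure.restrict_union disjoint_sdiff_right
        ((hBm N).diff (hUm N)), lintegral_add_measure, mul_add]
      exact (OTe_add _ _ _ _ _).trans (add_le_add ih (hq N))
  have htail : Tendsto (fun N => ∫⁻ y in (U N)ᶜ, wt p y ∂μ) atTop (𝓝 0) := by
    have h1 : Tendsto (fun N => μ.withDensity (wt p) ((U N)ᶜ)) atTop
        (𝓝 (μ.withDensity (wt p) (⋂ N, (U N)ᶜ))) := by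
      refine tendsto_measure_iInter_atTop (fun N => (hUm N).compl.nullMeasurableSet) ?_ ⟨0, ?_⟩
      · refine antitone_nat_of_succ_le fun N => ?_
        rw [hUs]
        exact compl_subset_compl.2 subset_union_left
      · rw [withDensity_apply _ (hUm 0).compl]
        exact ne_top_of_le_ne_top hW (setLIntegral_le_lintegral _ _)
    have h2 : μ.withDensity (wt p) (⋂ N, (U N)ᶜ) = 0 := by
      refine withDensity_absolutelyContinuous _ _ (measure_mono_null ?_ hμ.1)
      intro y hy hyU
      obtain ⟨i, hi⟩ := hd y hyU (η * persDist y) (mul_pos hη (persDist_pos hyU))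
      have := mem_iInter.1 hy (i+1)
      refine this ?_
      simp only [U, mem_iUnion]
      exact ⟨i, by simp, hyU, hi⟩
    rw [h2] at h1
    simpa only [withDensity_apply _ (hUm _).compl] using h1
  obtain ⟨N, hN⟩ := (htail.eventually (gt_mem_nhds
    (show (0:ℝ≥0∞) < ε / 2 by simp [pos_iff_ne_zero, hε]))).exists
  refine ⟨N, fun i => q i, ?_⟩
  rw [Fin.sum_univ_eq_sum_range (fun i => ENNReal.ofReal (q i) • Measure.dirac (x i)) N]
  have hz : μ.restrict (U N)ᶜ UHPᶜ = 0 :=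
    le_antisymm ((Measure.restrict_le_self _).trans hμ.1.le) (zero_le)
  have h3 := OTe_add p (μ.restrict (U N))
    (∑ i ∈ Finset.range N, ENNReal.ofReal (q i) • Measure.dirac (x i)) (μ.restrict (U N)ᶜ) 0
  rw [Measure.restrict_add_restrict_compl (hUm N), add_zero] at h3
  have h4 : OTe p (μ.restrict (U N)ᶜ) 0 < ε / 2 := by
    refine (OTe_zero_le hp hz).trans_lt ?_
    rwa [Pers_eq' hz]
  have h5 : OTe p (μ.restrict (U N))
      (∑ i ∈ Finset.range N, ENNReal.ofReal (q i) • Measure.dirac (x i)) < ε / 2 :=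
    ((hind N).trans (by gcongr; exact Measure.restrict_le_self)).trans_lt hηK
  calc _ ≤ _ := h3
    _ < ε / 2 + ε / 2 := ENNReal.add_lt_add h5 h4
    _ = ε := ENNReal.add_halves ε

lemma MemMp_sum {p : ℝ} {x : ℕ → Pt} (hx : ∀ i, x i ∈ UHP) {N : ℕ} (q : Fin N → ℚ) :
    MemMp p (∑ i, ENNReal.ofReal (q i) • Measure.dirac (x i)) := by
  have h0 : (∑ i, ENNReal.ofReal (q i) • Measure.dirac (x i) : Measure Pt) UHPᶜ = 0 := by
    simp [Measure.finsetSum_apply, Measure.dirac_apply' _ meas_UHP.compl, hx]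
  refine ⟨h0, ?_⟩
  rw [Pers_eq' h0, lintegral_finsetSum_measure]
  refine ENNReal.sum_lt_top.2 fun i _ => ?_
  rw [lintegral_smul_measure, lintegral_dirac' _ (meas_wt p), smul_eq_mul]
  exact ENNReal.mul_lt_top ENNReal.ofReal_lt_top wt_top.lt_top

lemma exists_seq : ∃ x : ℕ → Pt, (∀ i, x i ∈ UHP) ∧
    ∀ y ∈ UHP, ∀ ε > 0, ∃ i, dist y (x i) < ε := by
  have : Nonempty UHP := ⟨⟨mk2 0 1, by simp [mk2, UHP]⟩⟩
  refine ⟨fun i => (TopologicalSpace.denseSeq UHP i : Pt), fun i => (TopologicalSpace.denseSeq UHP i).2, ?_⟩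
  intro y hy ε hε
  obtain ⟨i, hi⟩ := (TopologicalSpace.denseRange_denseSeq UHP).exists_dist_lt ⟨y, hy⟩ hε
  exact ⟨i, hi⟩

/-- The metric space structure. -/
def mpMetric (p : ℝ) (hp : 1 ≤ p) : MetricSpace (MpT p) where
  dist μ ν := OT p μ.1 ν.1
  dist_self μ := by
    have : 0 < p := by linarith
    simp [OT, OTe_self hp μ.2, this]
  dist_comm μ ν := by simp [OT, OTe_symm p μ.1]
  dist_triangle μ ν l := by
    have hp0 : 0 ≤ 1 / p := by positivity
    have := OT_triangle hp μ.2 ν.2 l.2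
    have h1 := ENNReal.rpow_ne_top_of_nonneg hp0 (OTe_ne_top hp μ.2 ν.2)
    have h2 := ENNReal.rpow_ne_top_of_nonneg hp0 (OTe_ne_top hp ν.2 l.2)
    unfold OT
    have := ENNReal.toReal_mono (ENNReal.add_ne_top.2 ⟨h1, h2⟩) this
    rwa [ENNReal.toReal_add h1 h2] at this
  eq_of_dist_eq_zero {μ ν} h := by
    have hp0 : 0 < 1 / p := by positivity
    have h1 := ENNReal.rpow_ne_top_of_nonneg hp0.le (OTe_ne_top hp μ.2 ν.2)
    have h' : (OTe p μ.1 ν.1 ^ (1 / p)).toReal = 0 := h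
    rw [ENNReal.toReal_eq_zero_iff, or_iff_left h1, ENNReal.rpow_eq_zero_iff_of_pos hp0] at h'
    exact Subtype.ext (eq_of_OTe_zero hp μ.2 ν.2 h')

/-- (M^p, OT_p) is a Polish (complete separable metric) space. -/
theorem stmt6 (p : ℝ) (hp : 1 ≤ p) :
    ∃ m : MetricSpace (MpT p),
      (∀ μ ν : MpT p, @dist _ m.toPseudoMetricSpace.toDist μ ν = OT p μ.1 ν.1) ∧
      @CompleteSpace _ m.toPseudoMetricSpace.toUniformSpace ∧
      @TopologicalSpace.SeparableSpace _
        m.toPseudoMetricSpace.toUniformSpace.toTopologicalSpace := by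
  letI m := mpMetric p hp
  have hdist : ∀ μ ν : MpT p, dist μ ν = (OTe p μ.1 ν.1 ^ (1 / p)).toReal := fun _ _ => rfl
  have hp0 : 0 < 1 / p := by positivity
  have hnt : ∀ μ ν : MpT p, OTe p μ.1 ν.1 ^ (1 / p) ≠ ⊤ := fun μ ν =>
    ENNReal.rpow_ne_top_of_nonneg hp0.le (OTe_ne_top hp μ.2 ν.2)
  refine ⟨m, fun _ _ => rfl, ?_, ?_⟩
  · refine Metric.complete_of_convergent_controlled_sequences (fun n => (2⁻¹ : ℝ) ^ n)
      (fun n => by positivity) ?_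
    intro u hu
    obtain ⟨μ, hμ, hlim⟩ := OT_complete hp (u := fun n => (u n).1) (fun n => (u n).2) (by
      intro n
      have h1 := hu n n (n+1) le_rfl (Nat.le_succ n)
      rw [hdist, ← ENNReal.lt_ofReal_iff_toReal_lt (hnt _ _)] at h1
      refine h1.trans_le (le_of_eq ?_)
      rw [ENNReal.ofReal_pow (by norm_num), ENNReal.ofReal_inv_of_pos (by norm_num)]
      simp)
    refine ⟨⟨μ, hμ⟩, tendsto_iff_dist_tendsto_zero.2 ?_⟩
    have := (ENNReal.tendsto_toReal ENNReal.zero_ne_top).comp hlim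
    exact this
  · obtain ⟨x, hx, hd⟩ := exists_seq
    let C : Set (MpT p) := ⋃ N : ℕ, range fun q : Fin N → ℚ =>
      (⟨∑ i, ENNReal.ofReal (q i) • Measure.dirac (x i), MemMp_sum hx q⟩ : MpT p)
    refine ⟨C, countable_iUnion fun N => countable_range _, Metric.dense_iff.2 ?_⟩
    intro μ r hr
    have hr' : ENNReal.ofReal r ^ p ≠ 0 := by
      have h1 : 0 < ENNReal.ofReal r := by simpa using hr
      exact (ENNReal.rpow_pos h1 ENNReal.ofReal_ne_top).ne'
    obtain ⟨N, q, hq⟩ := approx hp μ.2 hx hd hr'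
    let z : MpT p := ⟨_, MemMp_sum hx q⟩
    refine ⟨z, ?_, mem_iUnion.2 ⟨N, q, rfl⟩⟩
    rw [mem_ball, dist_comm, hdist, ← ENNReal.lt_ofReal_iff_toReal_lt (hnt _ _)]
    have := ENNReal.rpow_lt_rpow hq hp0
    rwa [← ENNReal.rpow_mul, mul_one_div_cancel (by positivity), ENNReal.rpow_one] at this
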